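/- For every integer m ≥ 3, setting q = 3^m and n = 2q, there exists a set of n(n−2)²/32 spanning trees of the complete graph on n vertices such that any two distinct trees in the set share at most 12 common edges; consequently A(n, n−13) ≥ n(n−2)²/32 for n = 2·3^m with m ≥ 3. -/

import Mathlib

/-- The tree-distance between two spanning trees on `Fin n`:
`d(T₁,T₂) = n - 1 - |E₁ ∩ E₂|`. -/
noncomputable def treeDist {n : ℕ} (G H : SimpleGraph (Fin n)) : ℕ :=
  n - 1 - (G.edgeSet ∩ H.edgeSet).ncard

/-- An `(n,d)` tree-code: a finite set of (spanning) trees on `Fin n`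
such that any two distinct members have tree-distance at least `d`. -/
def IsTreeCode (n d : ℕ) (C : Finset (SimpleGraph (Fin n))) : Prop :=
  (∀ G ∈ C, G.IsTree) ∧ ∀ G ∈ C, ∀ H ∈ C, G ≠ H → d ≤ treeDist G H

/-- `A n d`: the maximum size of an `(n,d)` tree-code. -/
noncomputable def A (n d : ℕ) : ℕ :=
  sSup {m : ℕ | ∃ C : Finset (SimpleGraph (Fin n)), IsTreeCode n d C ∧ C.card = m}

/-- An `(n,d;i)` tree-code: an `(n,d)` tree-code all of whose trees contain
a common set of at least `i` edges. -/
def IsTreeCodeCommon (n d i : ℕ) (C : Finset (SimpleGraph (Fin n))) : Prop :=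
  IsTreeCode n d C ∧
    ∃ E : Finset (Sym2 (Fin n)), i ≤ E.card ∧ ∀ G ∈ C, (E : Set (Sym2 (Fin n))) ⊆ G.edgeSet

/-- `Acommon n d i`: the maximum size of an `(n,d;i)` tree-code. -/
noncomputable def Acommon (n d i : ℕ) : ℕ :=
  sSup {m : ℕ | ∃ C : Finset (SimpleGraph (Fin n)), IsTreeCodeCommon n d i C ∧ C.card = m}

open SimpleGraph

section CubicTrees

variable {F : Type*} [Field F]

/-- The graph on two copies of `F` with edges `x — f x`, with edges `x — f (ω * x)` for
`x ≠ 0, 1`, and with one edge `f 0 — f 0 + 1` inside the second copy. -/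
def linkedMatchings (ω : F) (f : F → F) : SimpleGraph (F ⊕ F) :=
  fromEdgeSet ((Set.range fun x => s(Sum.inl x, Sum.inr (f x))) ∪
    ((fun x => s(Sum.inl x, Sum.inr (f (ω * x)))) '' {0, 1}ᶜ) ∪
    {s(Sum.inr (f 0), Sum.inr (f 0 + 1))})

lemma linkedMatchings_adj_apply (ω : F) (f : F → F) (x : F) :
    (linkedMatchings ω f).Adj (Sum.inl x) (Sum.inr (f x)) := by
  simp [linkedMatchings]

lemma linkedMatchings_adj_apply_mul (ω : F) (f : F → F) {x : F} (h0 : x ≠ 0) (h1 : x ≠ 1) :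
    (linkedMatchings ω f).Adj (Sum.inl x) (Sum.inr (f (ω * x))) := by
  rw [linkedMatchings, fromEdgeSet_adj]
  exact ⟨Or.inl (Or.inr ⟨x, by simp [h0, h1], rfl⟩), by simp⟩

lemma linkedMatchings_adj_link (ω : F) (f : F → F) :
    (linkedMatchings ω f).Adj (Sum.inr (f 0)) (Sum.inr (f 0 + 1)) := by
  simp [linkedMatchings]

/-- If every nonzero element of `F` is a power of `ω` and `f` is a permutation, then
`linkedMatchings ω f` is connected. -/
lemma linkedMatchings_connected {ω : F} {f : F → F} (hf : f.Surjective) (hω : ω ≠ 0)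
    (hgen : ∀ x : F, x ≠ 0 → ∃ k : ℕ, ω ^ k = x) : (linkedMatchings ω f).Connected := by
  have step (x : F) (h0 : x ≠ 0) (h1 : x ≠ 1) :
      (linkedMatchings ω f).Reachable (Sum.inl x) (Sum.inl (ω * x)) :=
    (linkedMatchings_adj_apply_mul ω f h0 h1).reachable.trans
      (linkedMatchings_adj_apply ω f (ω * x)).reachable.symm
  have powers (k : ℕ) :
      (linkedMatchings ω f).Reachable (Sum.inl ω) (Sum.inl (ω ^ (k + 1))) := by
    induction k with
    | zero => simp
    | succ k ih =>
      by_cases h1 : ω ^ (k + 1) = 1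
      · rw [pow_succ ω (k + 1), h1, one_mul]
      · rw [pow_succ' ω (k + 1)]
        exact ih.trans (step _ (pow_ne_zero _ hω) h1)
  have nonzero (x : F) (hx : x ≠ 0) :
      (linkedMatchings ω f).Reachable (Sum.inl ω) (Sum.inl x) := by
    obtain ⟨k, hk⟩ := hgen (ω⁻¹ * x) (mul_ne_zero (inv_ne_zero hω) hx)
    have := powers k
    rwa [pow_succ', hk, mul_inv_cancel_left₀ hω] at this
  have left (x : F) : (linkedMatchings ω f).Reachable (Sum.inl ω) (Sum.inl x) := by
    by_cases hx : x = 0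
    · subst hx
      obtain ⟨y, hy⟩ := hf (f 0 + 1)
      have hy0 : y ≠ 0 := by
        rintro rfl
        simp at hy
      refine (nonzero y hy0).trans ((linkedMatchings_adj_apply ω f y).reachable.trans ?_)
      rw [hy]
      exact (linkedMatchings_adj_link ω f).reachable.symm.trans
        (linkedMatchings_adj_apply ω f 0).reachable.symm
    · exact nonzero x hx
  refine connected_iff_exists_forall_reachable _ |>.2 ⟨Sum.inl ω, ?_⟩
  rintro (x | y)
  · exact left x
  · obtain ⟨x, rfl⟩ := hf y
    exact (left x).trans (linkedMatchings_adj_apply ω f x).reachable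

lemma linkedMatchings_isTree [Finite F] {ω : F} {f : F → F} (hf : f.Surjective) (hω : ω ≠ 0)
    (hgen : ∀ x : F, x ≠ 0 → ∃ k : ℕ, ω ^ k = x) : (linkedMatchings ω f).IsTree := by
  have hconn := linkedMatchings_connected hf hω hgen
  refine isTree_iff_connected_and_card.2 ⟨hconn, le_antisymm ?_
    hconn.card_vert_le_card_edgeSet_add_one⟩
  have hsub : (linkedMatchings ω f).edgeSet ⊆
      (Set.range fun x => s(Sum.inl x, Sum.inr (f x))) ∪
      ((fun x => s(Sum.inl x, Sum.inr (f (ω * x)))) '' {0, 1}ᶜ) ∪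
      {s(Sum.inr (f 0), Sum.inr (f 0 + 1))} := by
    rw [linkedMatchings, edgeSet_fromEdgeSet]
    exact Set.sdiff_subset
  have hle := (Set.ncard_le_ncard hsub (Set.toFinite _)).trans
    ((Set.ncard_union_le _ _).trans (Nat.add_le_add_right (Set.ncard_union_le _ _) _))
  have hrange : (Set.range fun x => s(Sum.inl x, Sum.inr (f x))).ncard ≤ Nat.card F := by
    rw [← Set.image_univ, ← Set.ncard_univ]
    exact Set.ncard_image_le
  have himage : ((fun x => s(Sum.inl x, Sum.inr (f (ω * x)))) '' ({0, 1}ᶜ : Set F)).ncard ≤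
      ({0, 1}ᶜ : Set F).ncard := Set.ncard_image_le
  have hcompl := Set.ncard_add_ncard_compl ({0, 1} : Set F)
  rw [Set.ncard_pair zero_ne_one] at hcompl
  rw [Set.ncard_singleton] at hle
  rw [Nat.card_coe_set_eq, Nat.card_sum]
  omega

/-- Two graphs `linkedMatchings ω f` and `linkedMatchings ω g` have few common edges as soon as
each of `f`, `f (ω * ·)` agrees with each of `g`, `g (ω * ·)` in at most three points. -/
lemma linkedMatchings_inter_ncard_le [Finite F] {ω : F} {f g : F → F} (h2 : (2 : F) ≠ 0)
    (hff : {x | f x = g x}.ncard ≤ 3) (hfg : {x | f x = g (ω * x)}.ncard ≤ 3)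
    (hgf : {x | f (ω * x) = g x}.ncard ≤ 3)
    (hgg : {x | f (ω * x) = g (ω * x)}.ncard ≤ 3) :
    ((linkedMatchings ω f).edgeSet ∩ (linkedMatchings ω g).edgeSet).ncard ≤ 12 := by
  let u : F → Sym2 (F ⊕ F) := fun x => s(Sum.inl x, Sum.inr (f x))
  let v : F → Sym2 (F ⊕ F) := fun x => s(Sum.inl x, Sum.inr (f (ω * x)))
  let L : Set (Sym2 (F ⊕ F)) := {e | e = s(Sum.inr (f 0), Sum.inr (f 0 + 1)) ∧ f 0 = g 0}
  have hsub : (linkedMatchings ω f).edgeSet ∩ (linkedMatchings ω g).edgeSet ⊆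
      ((u '' {x | f x = g x} ∪ u '' {x | f x = g (ω * x)}) ∪
        (v '' ({x | f (ω * x) = g x} \ {0}) ∪ v '' ({x | f (ω * x) = g (ω * x)} \ {0}))) ∪ L := by
    rintro e ⟨he, he'⟩
    rw [linkedMatchings, edgeSet_fromEdgeSet] at he he'
    obtain ⟨(⟨x, rfl⟩ | ⟨x, hx, rfl⟩) | rfl, -⟩ := he <;>
      obtain ⟨(⟨y, hy⟩ | ⟨y, hy', hy⟩) | hy, -⟩ := he'
    · obtain ⟨rfl, hxy⟩ : y = x ∧ g y = f x := by simpa using hy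
      exact Or.inl (Or.inl (Or.inl ⟨y, hxy.symm, rfl⟩))
    · obtain ⟨rfl, hxy⟩ : y = x ∧ g (ω * y) = f x := by simpa using hy
      exact Or.inl (Or.inl (Or.inr ⟨y, hxy.symm, rfl⟩))
    · simp at hy
    · obtain ⟨rfl, hxy⟩ : y = x ∧ g y = f (ω * x) := by simpa using hy
      exact Or.inl (Or.inr (Or.inl ⟨y, ⟨hxy.symm, fun h => hx (Or.inl h)⟩, rfl⟩))
    · obtain ⟨rfl, hxy⟩ : y = x ∧ g (ω * y) = f (ω * x) := by simpa using hy
      exact Or.inl (Or.inr (Or.inr ⟨y, ⟨hxy.symm, fun h => hx (Or.inl h)⟩, rfl⟩))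
    · simp at hy
    · simp at hy
    · simp at hy
    · refine Or.inr ⟨rfl, ?_⟩
      simp only [Set.mem_singleton_iff, Sym2.eq_iff, Sum.inr.injEq] at hy
      rcases hy with ⟨h, -⟩ | ⟨h, h'⟩
      · exact h
      · exact absurd (by linear_combination h' - h) h2
  have hle := (Set.ncard_le_ncard hsub (Set.toFinite _)).trans
    ((Set.ncard_union_le _ _).trans (Nat.add_le_add_right ((Set.ncard_union_le _ _).trans
      (Nat.add_le_add (Set.ncard_union_le _ _) (Set.ncard_union_le _ _))) _))
  have image_le (w : F → Sym2 (F ⊕ F)) (s : Set F) : (w '' s).ncard ≤ s.ncard :=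
    Set.ncard_image_le
  have h₁ := image_le u {x | f x = g x}
  have h₂ := image_le u {x | f x = g (ω * x)}
  have h₃ := image_le v ({x | f (ω * x) = g x} \ {0})
  have h₄ := image_le v ({x | f (ω * x) = g (ω * x)} \ {0})
  by_cases h0 : f 0 = g 0
  · have hL : L.ncard ≤ 1 := by
      refine (Set.ncard_le_ncard (t := {s(Sum.inr (f 0), Sum.inr (f 0 + 1))}) ?_).trans
        (Set.ncard_singleton _).le
      exact fun e he => he.1
    rw [Set.ncard_sdiff_singleton_of_mem (by simp [h0])] at h₃ h₄
    omega
  · have hL : L = ∅ := Set.eq_empty_of_forall_notMem fun e he => h0 he.2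
    rw [hL, Set.ncard_empty] at hle
    have h₅ := Set.ncard_sdiff_singleton_le {x | f (ω * x) = g x} 0
    have h₆ := Set.ncard_sdiff_singleton_le {x | f (ω * x) = g (ω * x)} 0
    omega

lemma ncard_cubic_roots_le {a b c : F} (h : a = 0 → b = 0 → c ≠ 0) :
    {x | a * x ^ 3 + b * x + c = 0}.ncard ≤ 3 := by
  classical
  let p : Polynomial F := .C a * .X ^ 3 + .C b * .X + .C c
  have hp : p ≠ 0 := by
    intro hp
    have h3 : p.coeff 3 = a := by simp [p]
    have h1 : p.coeff 1 = b := by simp [p, Polynomial.coeff_C, Polynomial.coeff_X_pow]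
    have h0 : p.coeff 0 = c := by simp [p]
    rw [hp, Polynomial.coeff_zero] at h3 h1 h0
    exact h h3.symm h1.symm h0.symm
  have hdeg : p.natDegree ≤ 3 := by
    simp only [p]
    compute_degree
  have hset : {x | a * x ^ 3 + b * x + c = 0} = (p.roots.toFinset : Set F) := by
    ext x
    simp [hp, p, Polynomial.IsRoot]
  rw [hset, Set.ncard_coe_finset]
  exact (Multiset.toFinset_card_le _).trans ((Polynomial.card_roots' p).trans hdeg)

/-- In characteristic three, `x ↦ a * (x ^ 3 - c * x) + b` is injective if `a ≠ 0` and `c` is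
not a square. -/
lemma cubic_injective [CharP F 3] {a b c : F} (ha : a ≠ 0) (hc : ¬ IsSquare c) :
    Function.Injective fun x => a * (x ^ 3 - c * x) + b := by
  intro x y hxy
  have h3 : (3 : F) = 0 := by exact_mod_cast CharP.cast_eq_zero F 3
  have h : (x - y) * ((x - y) ^ 2 - c) = 0 := by
    have := mul_left_cancel₀ ha (add_right_cancel hxy)
    linear_combination this + (x * y ^ 2 - x ^ 2 * y) * h3
  rcases mul_eq_zero.1 h with h | h
  · exact sub_eq_zero.1 h
  · exact absurd ⟨x - y, by linear_combination -h⟩ hc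

lemma cubic_linkedMatchings_inter_ncard_le [Finite F] [CharP F 3] {ω a b c a' b' c' : F}
    (hω : ω ≠ 0) (ha : a ≠ 0) (h : a ≠ a' * ω ^ 3) (h' : a' ≠ a * ω ^ 3)
    (hne : ¬ (a = a' ∧ b = b' ∧ c = c')) :
    ((linkedMatchings ω fun x => a * (x ^ 3 - c * x) + b).edgeSet ∩
      (linkedMatchings ω fun x => a' * (x ^ 3 - c' * x) + b').edgeSet).ncard ≤ 12 := by
  have hdiff : a - a' = 0 → a' * c' - a * c = 0 → b - b' ≠ 0 := by
    intro h₁ h₂ h₃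
    rw [sub_eq_zero] at h₁ h₂ h₃
    subst h₁
    exact hne ⟨rfl, h₃, (mul_left_cancel₀ ha h₂).symm⟩
  have h2 : (2 : F) ≠ 0 := by
    have := CharP.cast_eq_zero F 3
    intro h2
    exact one_ne_zero (α := F) (by push_cast at this; linear_combination this - h2)
  refine linkedMatchings_inter_ncard_le h2 ?_ ?_ ?_ ?_
  · convert ncard_cubic_roots_le hdiff using 3
    funext x
    exact propext ⟨fun hx => by linear_combination hx, fun hx => by linear_combination hx⟩
  · convert ncard_cubic_roots_le (a := a - a' * ω ^ 3) (b := a' * c' * ω - a * c) (c := b - b')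
      (fun h0 => absurd (sub_eq_zero.1 h0) h) using 3
    funext x
    exact propext ⟨fun hx => by linear_combination hx, fun hx => by linear_combination hx⟩
  · convert ncard_cubic_roots_le (a := a * ω ^ 3 - a') (b := a' * c' - a * c * ω) (c := b - b')
      (fun h0 => absurd (sub_eq_zero.1 h0).symm h') using 3
    funext x
    exact propext ⟨fun hx => by linear_combination hx, fun hx => by linear_combination hx⟩
  · convert ncard_cubic_roots_le (a := (a - a') * ω ^ 3) (b := (a' * c' - a * c) * ω)
      (c := b - b') (fun h₁ h₂ => hdiff ((mul_eq_zero.1 h₁).resolve_right (pow_ne_zero _ hω))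
        ((mul_eq_zero.1 h₂).resolve_right hω)) using 3
    funext x
    exact propext ⟨fun hx => by linear_combination hx, fun hx => by linear_combination hx⟩

end CubicTrees

/-- A finite field of characteristic three with `2 * k + 1` elements yields
`(2 * k + 1) * k ^ 2` trees with pairwise at most twelve common edges. -/
lemma exists_trees_of_charThree {F : Type*} [Field F] [Finite F] [CharP F 3] {k : ℕ}
    (hF : Nat.card F = 2 * k + 1) :
    ∃ T : F × Fin k × Fin k → SimpleGraph (F ⊕ F), (∀ p, (T p).IsTree) ∧
      ∀ p p', p ≠ p' → ((T p).edgeSet ∩ (T p').edgeSet).ncard ≤ 12 := by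
  obtain ⟨g, hg⟩ := IsCyclic.exists_monoid_generator (α := Fˣ)
  have horder : orderOf g = 2 * k := by
    rw [orderOf_eq_card_of_forall_mem_powers hg, Nat.card_units, hF]
    rfl
  have pow_eq {i j : ℕ} (hij : (g : F) ^ i = (g : F) ^ j) : i ≡ j [MOD 2 * k] := by
    rw [← horder, ← pow_eq_pow_iff_modEq]
    exact_mod_cast hij
  have parity {i j : ℕ} (hij : (g : F) ^ i = (g : F) ^ j) : i % 2 = j % 2 :=
    (pow_eq hij).of_mul_right k
  have pow_inj {i j : ℕ} (hi : i < 2 * k) (hj : j < 2 * k) (hij : (g : F) ^ i = (g : F) ^ j) :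
      i = j := (pow_eq hij).eq_of_lt_of_lt hi hj
  have hgen (x : F) (hx : x ≠ 0) : ∃ i : ℕ, (g : F) ^ i = x := by
    obtain ⟨i, hi⟩ := hg (Units.mk0 x hx)
    exact ⟨i, by simpa using congrArg Units.val hi⟩
  have nonsquare (j : ℕ) : ¬ IsSquare ((g : F) ^ (2 * j + 1)) := by
    rintro ⟨s, hs⟩
    have hs0 : s ≠ 0 := by
      rintro rfl
      simp at hs
    obtain ⟨i, rfl⟩ := hgen s hs0
    rw [← pow_add] at hs
    have := parity hs
    omega
  have shift (i j : ℕ) : (g : F) ^ (2 * i) ≠ (g : F) ^ (2 * j) * (g : F) ^ 3 := by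
    rw [← pow_add]
    intro hij
    have := parity hij
    omega
  refine ⟨fun p => linkedMatchings (g : F) fun x =>
    (g : F) ^ (2 * (p.2.1 : ℕ)) * (x ^ 3 - (g : F) ^ (2 * (p.2.2 : ℕ) + 1) * x) + p.1,
    fun p => linkedMatchings_isTree
      (Finite.injective_iff_surjective.1 (cubic_injective (pow_ne_zero _ g.ne_zero) (nonsquare _)))
      g.ne_zero hgen, ?_⟩
  rintro ⟨b, i, j⟩ ⟨b', i', j'⟩ hne
  refine cubic_linkedMatchings_inter_ncard_le g.ne_zero (pow_ne_zero _ g.ne_zero) (shift _ _)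
    (shift _ _) ?_
  rintro ⟨hi, rfl, hj⟩
  have := pow_inj (by omega) (by omega) hi
  have := pow_inj (by omega) (by omega) hj
  exact hne (by ext <;> grind)

/-- Trees with few common edges may be moved to the vertex set `Fin n`. -/
lemma exists_finset_trees_fin {V P : Type*} [Finite V] [Finite P] {n t : ℕ} (hV : Nat.card V = n)
    (hn : t + 1 < n) (T : P → SimpleGraph V) (htree : ∀ p, (T p).IsTree)
    (hT : ∀ p p', p ≠ p' → ((T p).edgeSet ∩ (T p').edgeSet).ncard ≤ t) :
    ∃ C : Finset (SimpleGraph (Fin n)), (∀ G ∈ C, G.IsTree) ∧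
      (∀ G ∈ C, ∀ H ∈ C, G ≠ H → (G.edgeSet ∩ H.edgeSet).ncard ≤ t) ∧ C.card = Nat.card P := by
  classical
  have := Fintype.ofFinite P
  let e : V ≃ Fin n := Finite.equivFinOfCardEq hV
  have hinj : T.Injective := by
    intro p p' hpp
    by_contra hne
    have hle := hT p p' hne
    have hcard := (isTree_iff_connected_and_card.1 (htree p)).2
    rw [← hpp, Set.inter_self] at hle
    rw [Nat.card_coe_set_eq] at hcard
    omega
  have hinj' : Function.Injective fun p => (T p).map e.toEmbedding :=
    (SimpleGraph.map_injective e.toEmbedding).comp hinj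
  refine ⟨Finset.univ.image fun p => (T p).map e.toEmbedding, ?_, ?_, ?_⟩
  · simp only [Finset.mem_image, Finset.mem_univ, true_and, forall_exists_index,
      forall_apply_eq_imp_iff]
    exact fun p => (SimpleGraph.Iso.map e (T p)).isTree_iff.1 (htree p)
  · simp only [Finset.mem_image, Finset.mem_univ, true_and, forall_exists_index,
      forall_apply_eq_imp_iff]
    intro p p' hne
    rw [edgeSet_map, edgeSet_map, ← Set.image_inter (Function.Embedding.injective _),
      Set.ncard_image_of_injective _ (Function.Embedding.injective _)]
    exact hT p p' fun h => hne (by rw [h])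
  · rw [Finset.card_image_of_injective _ hinj', Finset.card_univ, Nat.card_eq_fintype_card]

lemma card_le_A {n d : ℕ} {C : Finset (SimpleGraph (Fin n))} (hC : IsTreeCode n d C) :
    C.card ≤ A n d := by
  classical
  refine le_csSup ⟨Fintype.card (SimpleGraph (Fin n)), ?_⟩ ⟨C, hC, rfl⟩
  rintro _ ⟨D, -, rfl⟩
  exact D.card_le_univ

theorem stmt19 (m : ℕ) (hm : 3 ≤ m) :
    (∃ C : Finset (SimpleGraph (Fin (2 * 3 ^ m))),
        (∀ G ∈ C, G.IsTree) ∧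
        (∀ G ∈ C, ∀ H ∈ C, G ≠ H → (G.edgeSet ∩ H.edgeSet).ncard ≤ 12) ∧
        C.card = 2 * 3 ^ m * (2 * 3 ^ m - 2) ^ 2 / 32) ∧
      2 * 3 ^ m * (2 * 3 ^ m - 2) ^ 2 / 32 ≤ A (2 * 3 ^ m) (2 * 3 ^ m - 13) := by
  obtain ⟨k, hk⟩ : Odd (3 ^ m) := Odd.pow (by decide)
  have hq : 3 ^ 3 ≤ 3 ^ m := Nat.pow_le_pow_right (by norm_num) hm
  have hcard : Nat.card (GaloisField 3 m) = 3 ^ m := GaloisField.card 3 m (by omega)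
  obtain ⟨T, htree, hT⟩ := exists_trees_of_charThree (F := GaloisField 3 m) (k := k)
    (hcard.trans hk)
  obtain ⟨C, hCtree, hCinter, hCcard⟩ := exists_finset_trees_fin (n := 2 * 3 ^ m) (t := 12)
    (by rw [Nat.card_sum, hcard, two_mul]) (by omega) T htree hT
  have hsize : C.card = 2 * 3 ^ m * (2 * 3 ^ m - 2) ^ 2 / 32 := by
    have hsub : 2 * (2 * k + 1) - 2 = 4 * k := by omega
    rw [hCcard, Nat.card_prod, Nat.card_prod, hcard, Nat.card_fin, hk, hsub]
    refine (Nat.div_eq_of_eq_mul_left (by norm_num) ?_).symm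
    ring
  refine ⟨⟨C, hCtree, hCinter, hsize⟩, hsize ▸ card_le_A ⟨hCtree, fun G hG H hH hne => ?_⟩⟩
  have := hCinter G hG H hH hne
  rw [treeDist]
  omega
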